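/- The function Ψ(x,t) := [(2t+1)x² + √(x⁴ + 4x²(t+1)t)] / (2(1−x²)) satisfies the quadratic equation (1−x²)Ψ² − (2t+1)x²Ψ − x²t(t+1) = 0 and solves the PDE ∂Ψ/∂t(x,t) = x·(∂Ψ/∂x)(x,t)/Ψ(x,t) − 1 for all 0<x<1 and t>0. Its x-derivative equals ψ(x,t) = x(2t+1)/(1−x²)² + (x² + 2t² + 2t²x² + 2t + 2tx²)/((1−x²)²·√(x² + 4(t+1)t)). -/

import Mathlib

/-- The distribution function of the radial parts for the hyperbolic case `α = 1/2`
(zeroes distributed according to the hyperbolic area measure on the unit disk). -/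
noncomputable def PsiHyp (x t : ℝ) : ℝ :=
  ((2 * t + 1) * x ^ 2 + Real.sqrt (x ^ 4 + 4 * x ^ 2 * (t + 1) * t)) / (2 * (1 - x ^ 2))

lemma sqrt_radicand_eq {x : ℝ} (hx : 0 ≤ x) (t : ℝ) :
    √(x ^ 4 + 4 * x ^ 2 * (t + 1) * t) = x * √(x ^ 2 + 4 * (t + 1) * t) := by
  rw [show x ^ 4 + 4 * x ^ 2 * (t + 1) * t = x ^ 2 * (x ^ 2 + 4 * (t + 1) * t) by ring,
    Real.sqrt_mul (sq_nonneg x), Real.sqrt_sq hx]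

lemma hasDerivAt_PsiHyp_time {x t : ℝ} (hx0 : 0 < x) (ht : 0 < t) :
    HasDerivAt (fun s => PsiHyp x s)
      (x * (x * √(x ^ 2 + 4 * (t + 1) * t) + 2 * t + 1) /
        (√(x ^ 2 + 4 * (t + 1) * t) * (1 - x ^ 2))) t := by
  have hR : 0 < √(x ^ 2 + 4 * (t + 1) * t) := Real.sqrt_pos.2 (by positivity)
  have hq : x ^ 4 + 4 * x ^ 2 * (t + 1) * t ≠ 0 := by positivity
  have hid := hasDerivAt_id' t
  have h := (((((hid.const_mul 2).add_const 1).mul_const (x ^ 2)).add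
    (((((hid.add_const 1).const_mul (4 * x ^ 2)).mul hid).const_add (x ^ 4)).sqrt hq)).div_const
      (2 * (1 - x ^ 2)))
  refine h.congr_deriv ?_
  simp only [Pi.mul_apply]
  rw [sqrt_radicand_eq hx0.le]
  generalize √(x ^ 2 + 4 * (t + 1) * t) = R at hR ⊢
  rcases eq_or_ne (1 - x ^ 2) 0 with h0 | h0
  · simp [h0]
  · field_simp
    ring

lemma hasDerivAt_PsiHyp_space {x t : ℝ} (hx0 : 0 < x) (hx1 : x < 1) (ht : 0 < t) :
    HasDerivAt (fun y => PsiHyp y t)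
      (x * (2 * t + 1) / (1 - x ^ 2) ^ 2 +
        (x ^ 2 + 2 * t ^ 2 + 2 * t ^ 2 * x ^ 2 + 2 * t + 2 * t * x ^ 2) /
          ((1 - x ^ 2) ^ 2 * √(x ^ 2 + 4 * (t + 1) * t))) x := by
  have hR : 0 < √(x ^ 2 + 4 * (t + 1) * t) := Real.sqrt_pos.2 (by positivity)
  have hR2 : √(x ^ 2 + 4 * (t + 1) * t) ^ 2 = x ^ 2 + 4 * (t + 1) * t :=
    Real.sq_sqrt (by positivity)
  have hq : x ^ 4 + 4 * x ^ 2 * (t + 1) * t ≠ 0 := by positivity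
  have h1 : 1 - x ^ 2 ≠ 0 := by nlinarith
  have h2 := hasDerivAt_pow 2 x
  have h := (((h2.const_mul (2 * t + 1)).add
    (((hasDerivAt_pow 4 x).add
      (((h2.const_mul 4).mul_const (t + 1)).mul_const t)).sqrt hq)).div
      ((h2.const_sub 1).const_mul 2) (mul_ne_zero two_ne_zero h1))
  refine h.congr_deriv ?_
  simp only [Pi.add_apply]
  rw [sqrt_radicand_eq hx0.le]
  generalize √(x ^ 2 + 4 * (t + 1) * t) = R at hR hR2 ⊢
  field_simp
  push_cast
  ring_nf
  rw [hR2]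
  ring

/-- `Ψ(x,t) = ((2t+1)x² + √(x⁴ + 4x²(t+1)t))/(2(1−x²))` satisfies
`(1−x²)Ψ² − (2t+1)x²Ψ − x²t(t+1) = 0` and solves `∂Ψ/∂t = x·(∂Ψ/∂x)/Ψ − 1` for all
`0 < x < 1` and `t > 0`; its `x`-derivative equals
`x(2t+1)/(1−x²)² + (x² + 2t² + 2t²x² + 2t + 2tx²)/((1−x²)²√(x² + 4(t+1)t))`. -/
theorem stmt_13 :
    ∀ t > (0:ℝ), ∀ x ∈ Set.Ioo (0:ℝ) 1,
      (1 - x ^ 2) * (PsiHyp x t) ^ 2 - (2 * t + 1) * x ^ 2 * PsiHyp x t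
          - x ^ 2 * t * (t + 1) = 0 ∧
      deriv (fun s => PsiHyp x s) t
          = x * deriv (fun y => PsiHyp y t) x / PsiHyp x t - 1 ∧
      deriv (fun y => PsiHyp y t) x
          = x * (2 * t + 1) / (1 - x ^ 2) ^ 2 +
            (x ^ 2 + 2 * t ^ 2 + 2 * t ^ 2 * x ^ 2 + 2 * t + 2 * t * x ^ 2) /
              ((1 - x ^ 2) ^ 2 * Real.sqrt (x ^ 2 + 4 * (t + 1) * t)) := by
  rintro t ht x ⟨hx0, hx1⟩
  have hR : 0 < √(x ^ 2 + 4 * (t + 1) * t) := Real.sqrt_pos.2 (by positivity)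
  have hR2 : √(x ^ 2 + 4 * (t + 1) * t) ^ 2 = x ^ 2 + 4 * (t + 1) * t :=
    Real.sq_sqrt (by positivity)
  have h1 : 1 - x ^ 2 ≠ 0 := by nlinarith
  rw [(hasDerivAt_PsiHyp_time hx0 ht).deriv, (hasDerivAt_PsiHyp_space hx0 hx1 ht).deriv,
    PsiHyp, sqrt_radicand_eq hx0.le]
  generalize √(x ^ 2 + 4 * (t + 1) * t) = R at hR hR2 ⊢
  refine ⟨?_, ?_, rfl⟩
  · field_simp
    linear_combination x ^ 2 * hR2
  · have hN : (2 * t + 1) * x + R ≠ 0 := by positivity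
    field_simp
    linear_combination hR2
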